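/- Suppose Assumption 1 holds, only Y is mismeasured (Z'=Z and D'=D almost surely), all conditioning events have positive probability, P(U=c) > 0, and define the differential sensitivities and specificities SN_Y^1 = P(Y'=1|Y=1,Z=1), SN_Y^0 = P(Y'=1|Y=1,Z=0), SP_Y^1 = P(Y'=0|Y=0,Z=1), SP_Y^0 = P(Y'=0|Y=0,Z=0), with SN_Y^1 + SP_Y^1 − 1 ≠ 0, SN_Y^0 + SP_Y^0 − 1 ≠ 0, and RD_{D|Z} ≠ 0. Then CACE = { [P(Y'=1|Z=1) − (1−SP_Y^1)] / (SN_Y^1 + SP_Y^1 − 1) − [P(Y'=1|Z=0) − (1−SP_Y^0)] / (SN_Y^0 + SP_Y^0 − 1) } / RD_{D|Z}, where CACE = E(Y_1 − Y_0 | U=c). -/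

import Mathlib

open MeasureTheory ProbabilityTheory

noncomputable def pr {Ω : Type*} [MeasurableSpace Ω] (μ : MeasureTheory.Measure Ω)
    (A : Set Ω) : ℝ := (μ A).toReal

noncomputable def cpr {Ω : Type*} [MeasurableSpace Ω] (μ : MeasureTheory.Measure Ω)
    (B A : Set Ω) : ℝ := (ProbabilityTheory.cond μ B A).toReal

def bin01 : Set ℝ := {0, 1}

/-- Conditional probability of an event as a ratio of real-valued measures. -/
lemma cpr_eq_div {Ω : Type*} [MeasurableSpace Ω] (μ : Measure Ω) {B : Set Ω}
    (hB : MeasurableSet B) (A : Set Ω) : cpr μ B A = μ.real (B ∩ A) / μ.real B := by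
  rw [cpr, cond_apply hB, ENNReal.toReal_mul, ENNReal.toReal_inv, div_eq_inv_mul]
  rfl

/-- Correction for misclassification of the event `T` as `T'` within `S`. -/
lemma cpr_eq_of_misclassified {Ω : Type*} [MeasurableSpace Ω] (μ : Measure Ω)
    [IsFiniteMeasure μ] {S T T' : Set Ω} (hS : MeasurableSet S) (hT : MeasurableSet T)
    (hT' : MeasurableSet T') (hpos : μ (T ∩ S) ≠ 0) (hneg : μ (Tᶜ ∩ S) ≠ 0)
    (hr : cpr μ (T ∩ S) T' + cpr μ (Tᶜ ∩ S) T'ᶜ - 1 ≠ 0) :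
    (cpr μ S T' - (1 - cpr μ (Tᶜ ∩ S) T'ᶜ)) / (cpr μ (T ∩ S) T' + cpr μ (Tᶜ ∩ S) T'ᶜ - 1)
      = cpr μ S T := by
  rw [div_eq_iff hr]
  rw [cpr_eq_div μ hS, cpr_eq_div μ hS, cpr_eq_div μ (hT.inter hS),
    cpr_eq_div μ (hT.compl.inter hS)]
  have hp : μ.real (T ∩ S) ≠ 0 := (measureReal_ne_zero_iff).2 hpos
  have hn : μ.real (Tᶜ ∩ S) ≠ 0 := (measureReal_ne_zero_iff).2 hneg
  have hs : μ.real S ≠ 0 := (measureReal_ne_zero_iff).2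
    fun h => hpos (measure_mono_null Set.inter_subset_right h)
  have e1 := measureReal_inter_add_sdiff (μ := μ) (s := S) hT
  have e2 := measureReal_inter_add_sdiff (μ := μ) (s := S ∩ T') hT
  have e3 := measureReal_inter_add_sdiff (μ := μ) (s := Tᶜ ∩ S) hT'
  rw [show S \ T = Tᶜ ∩ S by grind, Set.inter_comm S T] at e1
  rw [show (S ∩ T') \ T = Tᶜ ∩ S ∩ T' by grind,
    show S ∩ T' ∩ T = T ∩ S ∩ T' by grind] at e2
  rw [Set.sdiff_eq] at e3
  rw [Set.inter_comm S T]
  rw [← e2, ← e1]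
  rw [← e1] at hs
  rw [← e3] at hn hs ⊢
  field_simp
  ring

/-- Under independence, conditioning on `Z` does not affect an event that agrees on `Z ∈ s`
with an event about `W`. -/
lemma cpr_eq_of_indepFun {Ω α β : Type*} [MeasurableSpace Ω] [MeasurableSpace α]
    [MeasurableSpace β] (μ : Measure Ω) [IsFiniteMeasure μ] {Z : Ω → α} {W : Ω → β}
    (hZ : Measurable Z) (h : IndepFun Z W μ) {s : Set α} {t : Set β} (hs : MeasurableSet s)
    (ht : MeasurableSet t) (h0 : μ (Z ⁻¹' s) ≠ 0) {A : Set Ω}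
    (hA : Z ⁻¹' s ∩ A = Z ⁻¹' s ∩ W ⁻¹' t) : cpr μ (Z ⁻¹' s) A = μ.real (W ⁻¹' t) := by
  rw [cpr_eq_div μ (hZ hs), hA]
  have h1 : μ.real (Z ⁻¹' s) ≠ 0 := (measureReal_ne_zero_iff).2 h0
  rw [div_eq_iff h1, measureReal_def, h.measure_inter_preimage_eq_mul _ _ hs ht,
    ENNReal.toReal_mul, mul_comm]
  rfl

/-- Equal conditional probabilities give equal joint probabilities. -/
lemma measureReal_inter_eq_of_cpr_eq {Ω : Type*} [MeasurableSpace Ω] (μ : Measure Ω)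
    [IsFiniteMeasure μ] {B A A' : Set Ω} (hB : MeasurableSet B)
    (h : cpr μ B A = cpr μ B A') : μ.real (B ∩ A) = μ.real (B ∩ A') := by
  rw [cpr_eq_div μ hB, cpr_eq_div μ hB] at h
  by_cases h0 : μ.real B = 0
  · rw [measureReal_mono_null Set.inter_subset_left h0,
      measureReal_mono_null Set.inter_subset_left h0]
  · exact (div_left_inj' h0).1 h

/-- Splitting an event over three disjoint events that cover almost everything. -/
lemma measureReal_eq_add_of_ae_cover {Ω : Type*} [MeasurableSpace Ω] (μ : Measure Ω)
    [IsFiniteMeasure μ] {A N C G : Set Ω} (hA : MeasurableSet A) (hN : MeasurableSet N)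
    (hAN : Disjoint A N) (hAC : Disjoint A C) (hNC : Disjoint N C)
    (hcov : ∀ᵐ ω ∂μ, ω ∈ A ∨ ω ∈ N ∨ ω ∈ C) :
    μ.real G = μ.real (A ∩ G) + μ.real (N ∩ G) + μ.real (C ∩ G) := by
  have e1 := measureReal_inter_add_sdiff (μ := μ) (s := G) hA
  have e2 := measureReal_inter_add_sdiff (μ := μ) (s := G \ A) hN
  have e3 : μ.real ((G \ A) \ N) = μ.real (C ∩ G) := by
    apply measureReal_congr
    filter_upwards [hcov] with ω hω
    have h1 : ω ∈ A → ω ∉ C := fun h => Set.disjoint_left.1 hAC h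
    have h2 : ω ∈ N → ω ∉ C := fun h => Set.disjoint_left.1 hNC h
    apply propext
    change (ω ∈ (G \ A) \ N) ↔ ω ∈ C ∩ G
    simp only [Set.mem_sdiff, Set.mem_inter_iff]
    tauto
  have e4 : G \ A ∩ N = N ∩ G := by
    ext ω
    have h1 : ω ∈ A → ω ∉ N := fun h => Set.disjoint_left.1 hAN h
    simp only [Set.mem_sdiff, Set.mem_inter_iff]
    tauto
  rw [e4, e3] at e2
  rw [Set.inter_comm] at e1
  linarith

/-- The expectation of a binary variable is the probability of the value one. -/
lemma integrable_and_integral_of_binary {Ω : Type*} [MeasurableSpace Ω] (ν : Measure Ω)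
    [IsFiniteMeasure ν] {X : Ω → ℝ} (hX : Measurable X) (hb : ∀ ω, X ω = 0 ∨ X ω = 1) :
    Integrable X ν ∧ ∫ ω, X ω ∂ν = ν.real {ω | X ω = 1} := by
  have hm : MeasurableSet {ω | X ω = 1} := hX (measurableSet_singleton 1)
  have e : X = Set.indicator {ω | X ω = 1} 1 := by
    ext ω
    rcases hb ω with h | h <;> simp [Set.indicator, h]
  refine ⟨?_, ?_⟩
  · rw [e]
    exact (integrable_const (1 : ℝ)).indicator hm
  · conv_lhs => rw [e]
    exact integral_indicator_one hm

set_option maxHeartbeats 1000000 in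
theorem stmt16 {Ω : Type*} [MeasurableSpace Ω]
    (μ : MeasureTheory.Measure Ω) [IsProbabilityMeasure μ]
    (Z D Y Y' D1 D0 Y1 Y0 : Ω → ℝ)
    (h_meas_Z : Measurable Z)
    (h_meas_D : Measurable D)
    (h_meas_Y : Measurable Y)
    (h_meas_Yp : Measurable Y')
    (h_meas_D1 : Measurable D1)
    (h_meas_D0 : Measurable D0)
    (h_meas_Y1 : Measurable Y1)
    (h_meas_Y0 : Measurable Y0)
    (h_bin_Z : ∀ ω, Z ω = 0 ∨ Z ω = 1)
    (h_bin_Yp : ∀ ω, Y' ω = 0 ∨ Y' ω = 1)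
    (h_bin_D1 : ∀ ω, D1 ω = 0 ∨ D1 ω = 1)
    (h_bin_D0 : ∀ ω, D0 ω = 0 ∨ D0 ω = 1)
    (h_bin_Y1 : ∀ ω, Y1 ω = 0 ∨ Y1 ω = 1)
    (h_bin_Y0 : ∀ ω, Y0 ω = 0 ∨ Y0 ω = 1)
    (h_consD : ∀ ω, D ω = Z ω * D1 ω + (1 - Z ω) * D0 ω)
    (h_consY : ∀ ω, Y ω = Z ω * Y1 ω + (1 - Z ω) * Y0 ω)
    (h_indep : IndepFun Z (fun ω => (Y1 ω, Y0 ω, D1 ω, D0 ω)) μ)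
    (h_mono : ∀ᵐ ω ∂μ, D0 ω ≤ D1 ω)
    (h_exclA : cpr μ {ω | D1 ω = 1 ∧ D0 ω = 1} {ω | Y1 ω = 1}
        = cpr μ {ω | D1 ω = 1 ∧ D0 ω = 1} {ω | Y0 ω = 1})
    (h_exclN : cpr μ {ω | D1 ω = 0 ∧ D0 ω = 0} {ω | Y1 ω = 1}
        = cpr μ {ω | D1 ω = 0 ∧ D0 ω = 0} {ω | Y0 ω = 1})
    (h_posYZ : ∀ y ∈ bin01, ∀ z ∈ bin01,
      μ ({ω | Y ω = y} ∩ {ω | Z ω = z}) ≠ 0)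
    (h_Uc : 0 < pr μ {ω | D1 ω = 1 ∧ D0 ω = 0})
    (SNY1 SNY0 SPY1 SPY0 : ℝ)
    (h_SNY1 : SNY1 = cpr μ ({ω | Y ω = 1} ∩ {ω | Z ω = 1}) {ω | Y' ω = 1})
    (h_SNY0 : SNY0 = cpr μ ({ω | Y ω = 1} ∩ {ω | Z ω = 0}) {ω | Y' ω = 1})
    (h_SPY1 : SPY1 = cpr μ ({ω | Y ω = 0} ∩ {ω | Z ω = 1}) {ω | Y' ω = 0})
    (h_SPY0 : SPY0 = cpr μ ({ω | Y ω = 0} ∩ {ω | Z ω = 0}) {ω | Y' ω = 0})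
    (h_r1 : SNY1 + SPY1 - 1 ≠ 0) (h_r0 : SNY0 + SPY0 - 1 ≠ 0)
    (h_RDD : (cpr μ {ω | Z ω = 1} {ω | D ω = 1} - cpr μ {ω | Z ω = 0} {ω | D ω = 1}) ≠ 0) :
    ∫ ω, (Y1 ω - Y0 ω) ∂(ProbabilityTheory.cond μ {ω | D1 ω = 1 ∧ D0 ω = 0})
      = ((cpr μ {ω | Z ω = 1} {ω | Y' ω = 1} - (1 - SPY1)) / (SNY1 + SPY1 - 1)
          - (cpr μ {ω | Z ω = 0} {ω | Y' ω = 1} - (1 - SPY0)) / (SNY0 + SPY0 - 1))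
        / (cpr μ {ω | Z ω = 1} {ω | D ω = 1} - cpr μ {ω | Z ω = 0} {ω | D ω = 1}) := by
  have mset : ∀ {X : Ω → ℝ}, Measurable X → ∀ x : ℝ, MeasurableSet {ω | X ω = x} :=
    fun hX x => hX (measurableSet_singleton x)
  have h_bin_Y : ∀ ω, Y ω = 0 ∨ Y ω = 1 := by
    intro ω
    rw [h_consY]
    rcases h_bin_Z ω with h | h <;> simp [h, h_bin_Y0 ω, h_bin_Y1 ω]
  have compl_one : ∀ {X : Ω → ℝ}, (∀ ω, X ω = 0 ∨ X ω = 1) →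
      {ω | X ω = 0} = {ω | X ω = 1}ᶜ := by
    intro X hX
    ext ω
    rcases hX ω with h | h <;> simp [h]
  have recover : ∀ z ∈ bin01,
      cpr μ ({ω | Y ω = 1} ∩ {ω | Z ω = z}) {ω | Y' ω = 1}
        + cpr μ ({ω | Y ω = 0} ∩ {ω | Z ω = z}) {ω | Y' ω = 0} - 1 ≠ 0 →
      (cpr μ {ω | Z ω = z} {ω | Y' ω = 1}
          - (1 - cpr μ ({ω | Y ω = 0} ∩ {ω | Z ω = z}) {ω | Y' ω = 0}))
        / (cpr μ ({ω | Y ω = 1} ∩ {ω | Z ω = z}) {ω | Y' ω = 1}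
          + cpr μ ({ω | Y ω = 0} ∩ {ω | Z ω = z}) {ω | Y' ω = 0} - 1)
        = cpr μ {ω | Z ω = z} {ω | Y ω = 1} := by
    intro z hz
    have hp := h_posYZ 1 (by simp [bin01]) z hz
    have hn := h_posYZ 0 (by simp [bin01]) z hz
    rw [compl_one h_bin_Y] at hn ⊢
    rw [compl_one h_bin_Yp]
    exact cpr_eq_of_misclassified μ (mset h_meas_Z z) (mset h_meas_Y 1) (mset h_meas_Yp 1) hp hn
  have hZ : ∀ z ∈ bin01, μ {ω | Z ω = z} ≠ 0 := fun z hz h =>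
    h_posYZ 1 (by simp [bin01]) z hz (measure_mono_null Set.inter_subset_right h)
  have hZ1 := hZ 1 (by simp [bin01])
  have hZ0 := hZ 0 (by simp [bin01])
  have eY1 : cpr μ {ω | Z ω = 1} {ω | Y ω = 1} = μ.real {ω | Y1 ω = 1} := by
    refine cpr_eq_of_indepFun μ h_meas_Z h_indep (s := {1}) (t := {p | p.1 = 1})
      (measurableSet_singleton 1) (measurable_fst (measurableSet_singleton 1)) hZ1 ?_
    ext ω
    simp +contextual [h_consY]
  have eY0 : cpr μ {ω | Z ω = 0} {ω | Y ω = 1} = μ.real {ω | Y0 ω = 1} := by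
    refine cpr_eq_of_indepFun μ h_meas_Z h_indep (s := {0}) (t := {p | p.2.1 = 1})
      (measurableSet_singleton 0)
      ((measurable_fst.comp measurable_snd) (measurableSet_singleton 1)) hZ0 ?_
    ext ω
    simp +contextual [h_consY]
  have eD1 : cpr μ {ω | Z ω = 1} {ω | D ω = 1} = μ.real {ω | D1 ω = 1} := by
    refine cpr_eq_of_indepFun μ h_meas_Z h_indep (s := {1}) (t := {p | p.2.2.1 = 1})
      (measurableSet_singleton 1) ((measurable_fst.comp (measurable_snd.comp measurable_snd))
        (measurableSet_singleton 1)) hZ1 ?_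
    ext ω
    simp +contextual [h_consD]
  have eD0 : cpr μ {ω | Z ω = 0} {ω | D ω = 1} = μ.real {ω | D0 ω = 1} := by
    refine cpr_eq_of_indepFun μ h_meas_Z h_indep (s := {0}) (t := {p | p.2.2.2 = 1})
      (measurableSet_singleton 0) ((measurable_snd.comp (measurable_snd.comp measurable_snd))
        (measurableSet_singleton 1)) hZ0 ?_
    ext ω
    simp +contextual [h_consD]
  subst h_SNY1 h_SNY0 h_SPY1 h_SPY0
  rw [recover 1 (by simp [bin01]) h_r1, recover 0 (by simp [bin01]) h_r0, eY1, eY0, eD1, eD0]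
  have hA : MeasurableSet {ω | D1 ω = 1 ∧ D0 ω = 1} := (mset h_meas_D1 1).inter (mset h_meas_D0 1)
  have hN : MeasurableSet {ω | D1 ω = 0 ∧ D0 ω = 0} := (mset h_meas_D1 0).inter (mset h_meas_D0 0)
  have hC : MeasurableSet {ω | D1 ω = 1 ∧ D0 ω = 0} := (mset h_meas_D1 1).inter (mset h_meas_D0 0)
  have split : ∀ G : Set Ω, μ.real G = μ.real ({ω | D1 ω = 1 ∧ D0 ω = 1} ∩ G)
      + μ.real ({ω | D1 ω = 0 ∧ D0 ω = 0} ∩ G) + μ.real ({ω | D1 ω = 1 ∧ D0 ω = 0} ∩ G) := by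
    intro G
    refine measureReal_eq_add_of_ae_cover μ hA hN ?_ ?_ ?_ ?_
    · exact Set.disjoint_left.2 fun ω h h' => by simp [h.1] at h'
    · exact Set.disjoint_left.2 fun ω h h' => by simp [h.2] at h'
    · exact Set.disjoint_left.2 fun ω h h' => by simp [h.1] at h'
    · filter_upwards [h_mono] with ω hω
      rcases h_bin_D1 ω with h1 | h1 <;> rcases h_bin_D0 ω with h0 | h0 <;>
        simp [h1, h0] at hω ⊢
      linarith
  have hD : μ.real {ω | D1 ω = 1} - μ.real {ω | D0 ω = 1}
      = μ.real {ω | D1 ω = 1 ∧ D0 ω = 0} := by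
    have e1 := measureReal_inter_add_sdiff (μ := μ) (s := {ω | D1 ω = 1}) (mset h_meas_D0 1)
    have e2 : {ω | D1 ω = 1} \ {ω | D0 ω = 1} = {ω | D1 ω = 1 ∧ D0 ω = 0} := by
      ext ω
      rcases h_bin_D0 ω with h | h <;> simp [h]
    have e3 : μ.real ({ω | D1 ω = 1} ∩ {ω | D0 ω = 1}) = μ.real {ω | D0 ω = 1} := by
      apply measureReal_congr
      filter_upwards [h_mono] with ω hω
      apply propext
      change (D1 ω = 1 ∧ D0 ω = 1) ↔ D0 ω = 1
      refine ⟨And.right, fun h => ⟨?_, h⟩⟩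
      rcases h_bin_D1 ω with h1 | h1
      · linarith
      · exact h1
    rw [e2, e3] at e1
    linarith
  have hI1 := integrable_and_integral_of_binary
    (ProbabilityTheory.cond μ {ω | D1 ω = 1 ∧ D0 ω = 0}) h_meas_Y1 h_bin_Y1
  have hI0 := integrable_and_integral_of_binary
    (ProbabilityTheory.cond μ {ω | D1 ω = 1 ∧ D0 ω = 0}) h_meas_Y0 h_bin_Y0
  rw [integral_sub hI1.1 hI0.1, hI1.2, hI0.2, hD]
  change cpr μ _ _ - cpr μ _ _ = _
  rw [cpr_eq_div μ hC, cpr_eq_div μ hC, ← sub_div, split {ω | Y1 ω = 1}, split {ω | Y0 ω = 1},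
    measureReal_inter_eq_of_cpr_eq μ hA h_exclA, measureReal_inter_eq_of_cpr_eq μ hN h_exclN]
  congr 1
  ring
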